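/- arXiv:1706.01786 — 2 statements merged into one kernel-verified Lean document; each statement's English description precedes it below -/
import Mathlib

section
/- Let (A_l)_{l≥0} and (u_l)_{l≥0} be real sequences with u_l ≠ 0 for all l, and suppose H^{(j)}_n ≠ 0 for all j ≥ 0 and n ≥ 1. Define M^{(j)}_0 = A_j / u_j, N^{(j)}_0 = 1 / u_j, and recursively M^{(j)}_n = (M^{(j+1)}_{n−1} − M^{(j)}_{n−1}) / e^{(j)}_n and N^{(j)}_n = (N^{(j+1)}_{n−1} − N^{(j)}_{n−1}) / e^{(j)}_n for n ≥ 1 (the e^{(j)}_n being nonzero under the stated hypotheses). Then for all j ≥ 0 and n ≥ 0, M^{(j)}_n = f^{(j)}_n(a) / H^{(j)}_{n+1} and N^{(j)}_n = f^{(j)}_n(I) / H^{(j)}_{n+1}; consequently, whenever f^{(j)}_n(I) ≠ 0, the quantity M^{(j)}_n / N^{(j)}_n equals the unique solution component A^{(j)}_n of the linear system A_l = A^{(j)}_n + Σ_{k=1}^n ᾱ_k u_{k+l−1}, l = j, …, j+n. -/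
/-- `hankel u j n` = the Hankel determinant `H^{(j)}_n = det (u_{j+i+k})_{0 ≤ i,k ≤ n-1}`
(with `H^{(j)}_0 = 1`, the determinant of the empty matrix). -/
noncomputable def hankel (u : ℕ → ℝ) (j n : ℕ) : ℝ :=
  Matrix.det (Matrix.of fun i k : Fin n => u (j + i + k))

/-- `eqd u j n = e^{(j)}_n = H^{(j)}_{n+1} H^{(j+1)}_{n-1} / (H^{(j)}_n H^{(j+1)}_n)`
for `n ≥ 1`, and `e^{(j)}_0 = 0` by convention. -/
noncomputable def eqd (u : ℕ → ℝ) (j n : ℕ) : ℝ :=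
  if n = 0 then 0 else
    hankel u j (n + 1) * hankel u (j + 1) (n - 1) / (hankel u j n * hankel u (j + 1) n)

/-- `fdet u b j n` = the determinant `f^{(j)}_n(b)`: determinant of the
`(n+1)×(n+1)` matrix whose entry in row `i` and column `k` (`0 ≤ k ≤ n-1`)
is `u (j+i+k)` and whose last column has entries `b (j+i)`. -/
noncomputable def fdet (u b : ℕ → ℝ) (j n : ℕ) : ℝ :=
  Matrix.det (Matrix.of fun i k : Fin (n + 1) =>
    if (k : ℕ) < n then u (j + i + k) else b (j + i))

/-- `Mrec A u n j = M^{(j)}_n`, defined by `M^{(j)}_0 = A_j / u_j` and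
`M^{(j)}_n = (M^{(j+1)}_{n-1} - M^{(j)}_{n-1}) / e^{(j)}_n`. -/
noncomputable def Mrec (A u : ℕ → ℝ) : ℕ → ℕ → ℝ
  | 0, j => A j / u j
  | (n + 1), j => (Mrec A u n (j + 1) - Mrec A u n j) / eqd u j (n + 1)

/-- `Nrec u n j = N^{(j)}_n`, defined by `N^{(j)}_0 = 1 / u_j` and
`N^{(j)}_n = (N^{(j+1)}_{n-1} - N^{(j)}_{n-1}) / e^{(j)}_n`. -/
noncomputable def Nrec (u : ℕ → ℝ) : ℕ → ℕ → ℝ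
  | 0, j => 1 / u j
  | (n + 1), j => (Nrec u n (j + 1) - Nrec u n j) / eqd u j (n + 1)

open Matrix in
theorem fdet_eq_cramer (u b : ℕ → ℝ) (j n : ℕ) :
    fdet u b j n = Matrix.cramer (Matrix.of fun i k : Fin (n + 1) => u (j + i + k))
      (fun i : Fin (n + 1) => b (j + i)) (Fin.last n) := by
  rw [Matrix.cramer_apply, fdet]
  congr 1
  ext i k
  by_cases hk : k = Fin.last n
  · subst hk; simp
  · have : (k : ℕ) < n := Fin.val_lt_last hk
    simp [Matrix.updateCol_ne hk, this]

theorem fdet_congr (u : ℕ → ℝ) {b b' : ℕ → ℝ} (j n : ℕ)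
    (h : ∀ i : Fin (n + 1), b (j + i) = b' (j + i)) : fdet u b j n = fdet u b' j n := by
  rw [fdet_eq_cramer, fdet_eq_cramer]
  simp only [h]

theorem fdet_add (u b b' : ℕ → ℝ) (j n : ℕ) :
    fdet u (fun l => b l + b' l) j n = fdet u b j n + fdet u b' j n := by
  simp only [fdet_eq_cramer]
  rw [← Pi.add_apply, ← map_add]
  rfl

theorem fdet_smul (u b : ℕ → ℝ) (c : ℝ) (j n : ℕ) :
    fdet u (fun l => c * b l) j n = c * fdet u b j n := by
  simp only [fdet_eq_cramer]
  rw [← smul_eq_mul, ← Pi.smul_apply, ← map_smul]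
  rfl

theorem fdet_sum (u : ℕ → ℝ) {m : ℕ} (b : Fin m → ℕ → ℝ) (j n : ℕ) :
    fdet u (fun l => ∑ k, b k l) j n = ∑ k, fdet u (b k) j n := by
  simp only [fdet_eq_cramer]
  rw [← Finset.sum_apply, ← map_sum]
  refine congrArg (fun w => Matrix.cramer _ w (Fin.last n)) ?_
  ext i
  simp

theorem fdet_shift_lt (u : ℕ → ℝ) (j n k : ℕ) (hk : k < n) :
    fdet u (fun l => u (l + k)) j n = 0 := by
  rw [fdet_eq_cramer, Matrix.cramer_row_self _ _ (⟨k, by omega⟩ : Fin (n + 1)) (by intro i; simp)]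
  rw [Pi.single_eq_of_ne]
  intro h
  have := congrArg Fin.val h
  simp at this
  omega

theorem fdet_shift_self (u : ℕ → ℝ) (j n : ℕ) :
    fdet u (fun l => u (l + n)) j n = hankel u j (n + 1) := by
  rw [fdet_eq_cramer, Matrix.cramer_row_self _ _ (Fin.last n) (by intro i; simp)]
  simp [hankel]

theorem fdet_delta_last (u : ℕ → ℝ) (j n : ℕ) :
    fdet u (fun l => if l = j + n then 1 else 0) j n = hankel u j n := by
  rw [fdet, Matrix.det_succ_column _ (Fin.last n), Finset.sum_eq_single (Fin.last n)]
  · simp [hankel, ← two_mul]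
    congr 1
    ext i k
    simp [Fin.succAbove_last]
  · intro i _ hi
    have : (i : ℕ) < n := Fin.val_lt_last hi
    simp [this.ne]
  · simp

theorem fdet_delta_out (u : ℕ → ℝ) (j n m : ℕ) (hm : j + n < m) :
    fdet u (fun l => if l = m then 1 else 0) j n = 0 := by
  rw [fdet_congr u (b' := fun l => 0 * 0) j n, fdet_smul u (fun _ => 0), zero_mul]
  intro i
  have := i.2
  rw [if_neg (by omega)]; simp

theorem fdet_key (u b : ℕ → ℝ) (j n : ℕ) (hH : hankel u j (n + 1) ≠ 0) :
    fdet u b (j + 1) n * hankel u j (n + 1) - fdet u b j n * hankel u (j + 1) (n + 1)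
      = hankel u (j + 1) n * fdet u b j (n + 1) := by
  set H : Matrix (Fin (n + 1)) (Fin (n + 1)) ℝ := Matrix.of fun i k => u (j + i + k) with hHd
  have hdet : IsUnit H.det := isUnit_iff_ne_zero.2 hH
  obtain ⟨c, hc⟩ : ∃ c, H.mulVec c = fun i : Fin (n + 1) => b (j + i) :=
    ⟨H⁻¹.mulVec _, by rw [Matrix.mulVec_mulVec, Matrix.mul_nonsing_inv _ hdet, Matrix.one_mulVec]⟩
  set d : ℝ := b (j + (n + 1)) - ∑ k : Fin (n + 1), c k * u (j + (n + 1) + k) with hd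
  set b' : ℕ → ℝ := fun l => (∑ k : Fin (n + 1), c k * u (l + k)) +
    d * (if l = j + (n + 1) then 1 else 0) with hb'
  have hbb : ∀ i, i ≤ n + 1 → b (j + i) = b' (j + i) := by
    intro i hi
    rcases Nat.lt_or_eq_of_le hi with h | h
    · have := congrFun hc ⟨i, h⟩
      simp only [hb', ← this, Matrix.mulVec, dotProduct, hHd, Matrix.of_apply]
      rw [if_neg (by omega)]
      simp [mul_comm]
    · subst h
      simp [hb', hd]
  have hgen : ∀ j' n', fdet u b' j' n' = (∑ k : Fin (n + 1), c k * fdet u (fun l => u (l + k)) j' n')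
      + d * fdet u (fun l => if l = j + (n + 1) then 1 else 0) j' n' := by
    intro j' n'
    rw [hb', fdet_add, fdet_smul, fdet_sum u (fun (k : Fin (n + 1)) l => c k * u (l + k))]
    simp only [fdet_smul]
  have e1 : fdet u b (j + 1) n = c (Fin.last n) * hankel u (j + 1) (n + 1)
      + d * hankel u (j + 1) n := by
    rw [fdet_congr u (b' := b') (j + 1) n, hgen, Fin.sum_univ_castSucc,
      ← fdet_shift_self, ← fdet_delta_last]
    · rw [Finset.sum_eq_zero]
      · simp [add_assoc, add_comm 1 n]
      · intro k _
        rw [fdet_shift_lt _ _ _ _ (by simp), mul_zero]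
    · intro i
      have := hbb (1 + i) (by omega)
      rwa [← add_assoc] at this
  have e2 : fdet u b j n = c (Fin.last n) * hankel u j (n + 1) := by
    rw [fdet_congr u (b' := b') j n, hgen, Fin.sum_univ_castSucc,
      ← fdet_shift_self, fdet_delta_out _ _ _ _ (by omega)]
    · rw [Finset.sum_eq_zero]
      · simp
      · intro k _
        rw [fdet_shift_lt _ _ _ _ (by simp), mul_zero]
    · intro i
      exact hbb i (by omega)
  have e3 : fdet u b j (n + 1) = d * hankel u j (n + 1) := by
    rw [fdet_congr u (b' := b') j (n + 1), hgen, fdet_delta_last, Finset.sum_eq_zero]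
    · simp
    · intro k _
      rw [fdet_shift_lt _ _ _ _ k.2, mul_zero]
    · intro i
      exact hbb i (by omega)
  rw [e1, e2, e3]
  ring

theorem fdet_step (u b : ℕ → ℝ) (hH : ∀ j n, 1 ≤ n → hankel u j n ≠ 0) (j n : ℕ) :
    (fdet u b (j + 1) n / hankel u (j + 1) (n + 1) - fdet u b j n / hankel u j (n + 1))
      / eqd u j (n + 1) = fdet u b j (n + 1) / hankel u j (n + 1 + 1) := by
  have h1 := hH j (n + 1) (by omega)
  have h2 := hH (j + 1) (n + 1) (by omega)
  have h3 := hH j (n + 1 + 1) (by omega)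
  have h4 : hankel u (j + 1) n ≠ 0 := by
    rcases Nat.eq_zero_or_pos n with h | h
    · subst h; simp [hankel]
    · exact hH _ _ h
  have key := fdet_key u b j n h1
  rw [eqd, if_neg (by omega), Nat.add_sub_cancel, div_sub_div _ _ h2 h1]
  rw [mul_comm (hankel u (j + 1) (n + 1)) (fdet u b j n), key]
  field_simp

theorem fdet_zero_div (u b : ℕ → ℝ) (j : ℕ) :
    b j / u j = fdet u b j 0 / hankel u j (0 + 1) := by
  simp [fdet, hankel]

theorem stmt_11 (A u : ℕ → ℝ) (hu : ∀ l, u l ≠ 0)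
    (hH : ∀ j n, 1 ≤ n → hankel u j n ≠ 0) :
    (∀ j n, Mrec A u n j = fdet u A j n / hankel u j (n + 1)) ∧
    (∀ j n, Nrec u n j = fdet u (fun _ => 1) j n / hankel u j (n + 1)) ∧
    (∀ j n, fdet u (fun _ => 1) j n ≠ 0 →
      (∃! p : ℝ × (Fin n → ℝ),
        ∀ i : Fin (n + 1), A (j + i) = p.1 + ∑ k : Fin n, p.2 k * u (j + i + k)) ∧
      ∀ (B : ℝ) (α : Fin n → ℝ),
        (∀ i : Fin (n + 1), A (j + i) = B + ∑ k : Fin n, α k * u (j + i + k)) →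
        Mrec A u n j / Nrec u n j = B) := by

  have hM : ∀ n j, Mrec A u n j = fdet u A j n / hankel u j (n + 1) := by
    intro n
    induction n with
    | zero => intro j; rw [Mrec]; exact fdet_zero_div u A j
    | succ n ih => intro j; rw [Mrec, ih, ih]; exact fdet_step u A hH j n
  have hN : ∀ n j, Nrec u n j = fdet u (fun _ => 1) j n / hankel u j (n + 1) := by
    intro n
    induction n with
    | zero => intro j; rw [Nrec]; exact fdet_zero_div u (fun _ => 1) j
    | succ n ih => intro j; rw [Nrec, ih, ih]; exact fdet_step u _ hH j n
  refine ⟨fun j n => hM n j, fun j n => hN n j, fun j n hf => ⟨?_, ?_⟩⟩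
  · set F : Matrix (Fin (n + 1)) (Fin (n + 1)) ℝ := Matrix.of fun i k =>
      if (k : ℕ) < n then u (j + i + k) else 1 with hF
    have hdet : IsUnit F.det := isUnit_iff_ne_zero.2 hf
    have hmul : ∀ (v : Fin (n + 1) → ℝ) (i : Fin (n + 1)), F.mulVec v i =
        v (Fin.last n) + ∑ k : Fin n, v k.castSucc * u (j + i + k) := by
      intro v i
      simp only [Matrix.mulVec, dotProduct, hF, Matrix.of_apply, Fin.sum_univ_castSucc]
      simp [add_comm, mul_comm]
    have hinj : Function.Injective F.mulVec :=
      Matrix.mulVec_injective_iff_isUnit.2 ((Matrix.isUnit_iff_isUnit_det _).2 hdet)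
    obtain ⟨v, hv⟩ : ∃ v, F.mulVec v = fun i : Fin (n + 1) => A (j + i) :=
      ⟨F⁻¹.mulVec _, by rw [Matrix.mulVec_mulVec, Matrix.mul_nonsing_inv _ hdet, Matrix.one_mulVec]⟩
    refine ⟨(v (Fin.last n), fun k => v k.castSucc), ?_, ?_⟩
    · intro i
      rw [← hmul, hv]
    · rintro ⟨B, α⟩ h
      have : (Fin.snoc α B : Fin (n + 1) → ℝ) = v := by
        apply hinj
        rw [hv]
        ext i
        rw [hmul, h i]
        simp
      rw [← this]
      simp
  · intro B α h
    have hA : fdet u A j n = B * fdet u (fun _ => 1) j n := by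
      rw [fdet_congr u (b' := fun l => B * 1 + ∑ k : Fin n, α k * u (l + k)) j n
        (fun i => by rw [h i, mul_one]), fdet_add, fdet_smul u (fun _ => 1),
        fdet_sum u (fun (k : Fin n) l => α k * u (l + k)), Finset.sum_eq_zero, add_zero]
      intro k _
      rw [fdet_smul u (fun l => u (l + k)), fdet_shift_lt _ _ _ _ k.2, mul_zero]
    have hh := hH j (n + 1) (by omega)
    rw [hM, hN, hA]
    field_simp
end

section
/- Let (A_l)_{l≥0} be a real sequence, set u_k = A_{k+1} − A_k, and define the ε-algorithm quantities by ε^{(j)}_{−1} = 0, ε^{(j)}_0 = A_j, and ε^{(j)}_{k+1} = ε^{(j+1)}_{k−1} + 1/(ε^{(j+1)}_k − ε^{(j)}_k) for j, k ≥ 0, assuming all the differences ε^{(j+1)}_k − ε^{(j)}_k arising in the recursion (for the indices involved) are nonzero. Fix j ≥ 0 and n ≥ 1 and suppose f^{(j)}_n(I) ≠ 0 with respect to the sequence (u_l), where I is the constant sequence 1. Then ε^{(j)}_{2n} = A^{(j)}_n, where A^{(j)}_n is the unique solution component B of the linear system A_l = B + Σ_{k=1}^n ᾱ_k u_{k+l−1},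 l = j, …, j+n. -/
/-- `epsRec A k j` is the ε-algorithm quantity `ε^{(j)}_{k-1}` (the first index is
shifted by one so that `epsRec A 0 j = ε^{(j)}_{-1} = 0` and
`epsRec A 1 j = ε^{(j)}_0 = A j`); the recursion is
`ε^{(j)}_{k+1} = ε^{(j+1)}_{k-1} + 1/(ε^{(j+1)}_k - ε^{(j)}_k)`. -/
noncomputable def epsRec (A : ℕ → ℝ) : ℕ → ℕ → ℝ
  | 0, _ => 0
  | 1, j => A j
  | (k + 2), j =>
      epsRec A k (j + 1) + 1 / (epsRec A (k + 1) (j + 1) - epsRec A (k + 1) j)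

open Polynomial in
/-- The pair of polynomial families attached to the even and the odd columns. -/
noncomputable def epsPoly (e o : ℕ → ℕ → ℝ) : ℕ → (ℕ → ℝ[X]) × (ℕ → ℝ[X])
  | 0 => (fun _ => 0, fun _ => 0)
  | (n + 1) =>
      let q : ℕ → ℝ[X] := fun j => (epsPoly e o n).2 (j + 1) +
        C ((e n (j + 1) - e n j)⁻¹) * (1 + (X - 1) * (epsPoly e o n).1 (j + 1))
      (fun j => (epsPoly e o n).1 (j + 1) +
        C ((o (n + 1) (j + 1) - o (n + 1) j)⁻¹) * q (j + 1), q)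

/-- The shift operator on sequences. -/
noncomputable def seqShift : Module.End ℝ (ℕ → ℝ) where
  toFun s := fun l => s (l + 1)
  map_add' _ _ := rfl
  map_smul' _ _ := rfl

open Polynomial in
/-- The action of a polynomial in the shift operator. -/
noncomputable def shiftAct (A : ℕ → ℝ) (p : ℝ[X]) (l : ℕ) : ℝ := (aeval seqShift p) A l

section
open Polynomial

theorem shiftAct_add (A : ℕ → ℝ) (p q : ℝ[X]) (l : ℕ) :
    shiftAct A (p + q) l = shiftAct A p l + shiftAct A q l := by
  simp [shiftAct]

theorem shiftAct_sub (A : ℕ → ℝ) (p q : ℝ[X]) (l : ℕ) :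
    shiftAct A (p - q) l = shiftAct A p l - shiftAct A q l := by
  simp [shiftAct]

theorem shiftAct_C_mul (A : ℕ → ℝ) (c : ℝ) (p : ℝ[X]) (l : ℕ) :
    shiftAct A (C c * p) l = c * shiftAct A p l := by
  simp [shiftAct, Algebra.algebraMap_eq_smul_one]

theorem shiftAct_one (A : ℕ → ℝ) (l : ℕ) : shiftAct A 1 l = A l := by
  simp [shiftAct]

theorem shiftAct_X_mul (A : ℕ → ℝ) (p : ℝ[X]) (l : ℕ) :
    shiftAct A (X * p) l = shiftAct A p (l + 1) := by
  simp [shiftAct, seqShift]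

theorem shiftAct_X_sub (A : ℕ → ℝ) (p : ℝ[X]) (l : ℕ) :
    shiftAct A ((X - 1) * p) l = shiftAct A p (l + 1) - shiftAct A p l := by
  rw [sub_mul, one_mul, shiftAct_sub, shiftAct_X_mul]

theorem seqShift_pow (A : ℕ → ℝ) (k l : ℕ) : (seqShift ^ k) A l = A (l + k) := by
  induction k generalizing l with
  | zero => simp
  | succ k ih =>
    rw [pow_succ']
    change (seqShift ^ k) A (l + 1) = _
    rw [ih]; congr 1; omega

theorem shiftAct_eq_sum (A : ℕ → ℝ) (p : ℝ[X]) (n l : ℕ) (h : p.natDegree < n) :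
    shiftAct A p l = ∑ k : Fin n, p.coeff k * A (l + k) := by
  rw [shiftAct, aeval_eq_sum_range' h, Finset.sum_range]
  simp [seqShift_pow]

theorem epsPoly_rhombus (e o : ℕ → ℕ → ℝ) (j T : ℕ)
    (ho0 : ∀ i, o 0 i = 0)
    (ho : ∀ n i, o (n + 1) i = o n (i + 1) + (e n (i + 1) - e n i)⁻¹)
    (he : ∀ n i, e (n + 1) i = e n (i + 1) + (o (n + 1) (i + 1) - o (n + 1) i)⁻¹)
    (hd : ∀ n i, j ≤ i → i + 2 * n < T → e n (i + 1) - e n i ≠ 0)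
    (hD : ∀ n i, j ≤ i → i + 2 * n + 1 < T → o (n + 1) (i + 1) - o (n + 1) i ≠ 0) (n : ℕ) :
    (∀ i, j ≤ i → i + 2 * n < T → (epsPoly e o n).1 (i + 1) - (epsPoly e o n).1 i =
      C (e n (i + 1) - e n i) * (epsPoly e o n).2 (i + 1)) ∧
    (∀ i, j ≤ i → i + 2 * n + 1 < T →
      (epsPoly e o (n + 1)).2 (i + 1) - (epsPoly e o (n + 1)).2 i =
      C (o (n + 1) (i + 1) - o (n + 1) i) * (1 + (X - 1) * (epsPoly e o n).1 (i + 1))) := by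
  have inv : ∀ x : ℝ, x ≠ 0 → (C x * C x⁻¹ : ℝ[X]) = 1 := fun x hx => by
    rw [← C_mul, mul_inv_cancel₀ hx, C_1]
  have hq : ∀ n i, (epsPoly e o (n + 1)).2 i = (epsPoly e o n).2 (i + 1) +
        C ((e n (i + 1) - e n i)⁻¹) * (1 + (X - 1) * (epsPoly e o n).1 (i + 1)) :=
    fun n i => rfl
  have ha : ∀ n i, (epsPoly e o (n + 1)).1 i = (epsPoly e o n).1 (i + 1) +
        C ((o (n + 1) (i + 1) - o (n + 1) i)⁻¹) * (epsPoly e o (n + 1)).2 (i + 1) :=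
    fun n i => rfl
  induction n with
  | zero =>
    refine ⟨fun i _ _ => by simp [epsPoly], fun i _ _ => ?_⟩
    simp [epsPoly, ho, ho0]
  | succ n ih =>
    obtain ⟨ihe, iho⟩ := ih
    have Re : ∀ i, j ≤ i → i + 2 * (n + 1) < T →
        (epsPoly e o (n + 1)).1 (i + 1) - (epsPoly e o (n + 1)).1 i =
        C (e (n + 1) (i + 1) - e (n + 1) i) * (epsPoly e o (n + 1)).2 (i + 1) := by
      intro i hi hT
      have h1 := ihe (i + 1) (by omega) (by omega)
      have h2 := iho (i + 1) (by omega) (by omega)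
      have h3 := hq n (i + 1)
      have h4 := inv _ (hd n (i + 1) (by omega) (by omega))
      have h5 := inv _ (hD n (i + 1) (by omega) (by omega))
      rw [ha n (i + 1), ha n i, he n (i + 1), he n i]
      generalize (o (n + 1) (i + 1 + 1) - o (n + 1) (i + 1)) = D1 at *
      generalize (o (n + 1) (i + 1) - o (n + 1) i)⁻¹ = D0i at *
      have h6 : e n (i + 1 + 1) + D1⁻¹ - (e n (i + 1) + D0i) =
        (e n (i + 1 + 1) - e n (i + 1)) + D1⁻¹ - D0i := by ring
      rw [h6]
      generalize (e n (i + 1 + 1) - e n (i + 1)) = d at *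
      simp only [C_add, C_sub]
      generalize (epsPoly e o (n + 1)).2 (i + 1) = q1 at *
      generalize (epsPoly e o (n + 1)).2 (i + 1 + 1) = q2 at *
      linear_combination h1 + C D1⁻¹ * h2 - C d * h3 +
        (1 + (X - 1) * (epsPoly e o n).1 (i + 1 + 1)) * (h5 - h4)
    refine ⟨Re, ?_⟩
    intro i hi hT
    have h1 := Re (i + 1) (by omega) (by omega)
    have h2 := iho (i + 1) (by omega) (by omega)
    have h3 := ha n (i + 1)
    have h4 := inv _ (hd (n + 1) (i + 1) (by omega) (by omega))
    have h5 := inv _ (hD n (i + 1) (by omega) (by omega))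
    rw [hq (n + 1) (i + 1), hq (n + 1) i, ho (n + 1) (i + 1), ho (n + 1) i]
    generalize (e (n + 1) (i + 1 + 1) - e (n + 1) (i + 1)) = d1 at *
    generalize (e (n + 1) (i + 1) - e (n + 1) i)⁻¹ = d0i at *
    have h6 : o (n + 1) (i + 1 + 1) + d1⁻¹ - (o (n + 1) (i + 1) + d0i) =
        (o (n + 1) (i + 1 + 1) - o (n + 1) (i + 1)) + d1⁻¹ - d0i := by ring
    rw [h6]
    generalize (o (n + 1) (i + 1 + 1) - o (n + 1) (i + 1)) = D at *
    simp only [C_add, C_sub]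
    generalize (epsPoly e o (n + 1)).2 (i + 1) = q1 at *
    generalize (epsPoly e o (n + 1)).2 (i + 1 + 1) = q2 at *
    linear_combination h2 + C d1⁻¹ * (X - 1) * h1 - C D * (X - 1) * h3 +
      (X - 1) * q2 * (h4 - h5)

theorem epsPoly_act (A : ℕ → ℝ) (e o : ℕ → ℕ → ℝ) (j T : ℕ)
    (he0 : ∀ i, e 0 i = A i) (ho0 : ∀ i, o 0 i = 0)
    (ho : ∀ n i, o (n + 1) i = o n (i + 1) + (e n (i + 1) - e n i)⁻¹)
    (he : ∀ n i, e (n + 1) i = e n (i + 1) + (o (n + 1) (i + 1) - o (n + 1) i)⁻¹)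
    (hd : ∀ n i, j ≤ i → i + 2 * n < T → e n (i + 1) - e n i ≠ 0)
    (hD : ∀ n i, j ≤ i → i + 2 * n + 1 < T → o (n + 1) (i + 1) - o (n + 1) i ≠ 0) (n : ℕ) :
    (∀ i, j ≤ i → i + 2 * n ≤ T → ∀ l, i ≤ l → l ≤ i + n →
      shiftAct A (1 + (X - 1) * (epsPoly e o n).1 i) l = e n i) ∧
    (∀ i, j ≤ i → i + 2 * n ≤ T + 1 → ∀ l, i ≤ l → l < i + n →
      shiftAct A ((X - 1) * (epsPoly e o n).2 i) l = 1) := by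
  have hq : ∀ n i, (epsPoly e o (n + 1)).2 i = (epsPoly e o n).2 (i + 1) +
        C ((e n (i + 1) - e n i)⁻¹) * (1 + (X - 1) * (epsPoly e o n).1 (i + 1)) :=
    fun n i => rfl
  have ha : ∀ n i, (epsPoly e o (n + 1)).1 i = (epsPoly e o n).1 (i + 1) +
        C ((o (n + 1) (i + 1) - o (n + 1) i)⁻¹) * (epsPoly e o (n + 1)).2 (i + 1) :=
    fun n i => rfl
  induction n with
  | zero =>
    refine ⟨fun i _ _ l h1 h2 => ?_, fun i _ _ l h1 h2 => by omega⟩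
    obtain rfl : l = i := by omega
    simp [epsPoly, shiftAct_one, he0]
  | succ n ih =>
    obtain ⟨ihe, iho⟩ := ih
    obtain ⟨Re, Ro⟩ := epsPoly_rhombus e o j T ho0 ho he hd hD n
    have Io : ∀ i, j ≤ i → i + 2 * (n + 1) ≤ T + 1 → ∀ l, i ≤ l → l < i + (n + 1) →
        shiftAct A ((X - 1) * (epsPoly e o (n + 1)).2 i) l = 1 := by
      intro i hi hT l hl hl'
      have hd' := hd n i hi (by omega)
      have key : (X - 1) * (epsPoly e o (n + 1)).2 i = (X - 1) * (epsPoly e o n).2 (i + 1) +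
        C ((e n (i + 1) - e n i)⁻¹) *
          ((X - 1) * (1 + (X - 1) * (epsPoly e o n).1 (i + 1))) := by
        rw [hq]; ring
      rw [key, shiftAct_add, shiftAct_C_mul, shiftAct_X_sub _ (1 + _),
        ihe (i + 1) (by omega) (by omega) (l + 1) (by omega) (by omega)]
      rcases Nat.eq_or_lt_of_le hl with rfl | hlt
      · have h1 : 1 + (X - 1) * (epsPoly e o n).1 (i + 1) = (1 + (X - 1) * (epsPoly e o n).1 i) +
            C (e n (i + 1) - e n i) * ((X - 1) * (epsPoly e o n).2 (i + 1)) := by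
          linear_combination (X - 1) * Re i hi (by omega)
        rw [h1, shiftAct_add, shiftAct_C_mul, ihe i hi (by omega) i (by omega) (by omega)]
        field_simp
        ring
      · rw [ihe (i + 1) (by omega) (by omega) l (by omega) (by omega),
          iho (i + 1) (by omega) (by omega) l (by omega) (by omega)]
        simp
    refine ⟨?_, Io⟩
    intro i hi hT l hl hl'
    have hD' := hD n i hi (by omega)
    have key : 1 + (X - 1) * (epsPoly e o (n + 1)).1 i =
        (1 + (X - 1) * (epsPoly e o n).1 (i + 1)) +
        C ((o (n + 1) (i + 1) - o (n + 1) i)⁻¹) *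
          ((X - 1) * (epsPoly e o (n + 1)).2 (i + 1)) := by
      rw [ha]; ring
    rw [key, shiftAct_add, shiftAct_C_mul, he]
    rcases Nat.eq_or_lt_of_le hl with rfl | hlt
    · have h1 : (X - 1) * (epsPoly e o (n + 1)).2 (i + 1) =
          (X - 1) * (epsPoly e o (n + 1)).2 i + C (o (n + 1) (i + 1) - o (n + 1) i) *
            ((X - 1) * (1 + (X - 1) * (epsPoly e o n).1 (i + 1))) := by
        linear_combination (X - 1) * Ro i hi (by omega)
      rw [h1, shiftAct_add A (_ * _) (C _ * _), shiftAct_C_mul, Io i hi (by omega) i (by omega) (by omega),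
        shiftAct_X_sub _ (1 + _), ihe (i + 1) (by omega) (by omega) (i + 1) (by omega) (by omega)]
      field_simp
      ring
    · rw [ihe (i + 1) (by omega) (by omega) l (by omega) (by omega),
        Io (i + 1) (by omega) (by omega) l (by omega) (by omega)]
      ring

theorem epsPoly_natDegree (e o : ℕ → ℕ → ℝ) (n : ℕ) :
    ∀ i, ((epsPoly e o (n + 1)).1 i).natDegree ≤ n ∧
      ((epsPoly e o (n + 1)).2 i).natDegree ≤ n := by
  induction n with
  | zero =>
    intro i
    have h : ∀ c : ℝ, (C c : ℝ[X]).natDegree ≤ 0 := fun c => by simp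
    constructor
    · simp only [epsPoly, mul_zero, add_zero, zero_add, mul_one]
      exact (natDegree_C_mul_le _ _).trans (h _)
    · simp [epsPoly]
  | succ n ih =>
    have hq : ∀ i, ((epsPoly e o (n + 1 + 1)).2 i).natDegree ≤ n + 1 := by
      intro i
      change ((epsPoly e o (n + 1)).2 (i + 1) + C ((e (n + 1) (i + 1) - e (n + 1) i)⁻¹) *
        (1 + (X - 1) * (epsPoly e o (n + 1)).1 (i + 1))).natDegree ≤ n + 1
      refine natDegree_add_le_of_degree_le ((ih _).2.trans (Nat.le_succ n)) ?_
      refine (natDegree_C_mul_le _ _).trans ?_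
      refine natDegree_add_le_of_degree_le (by simp) ?_
      refine natDegree_mul_le.trans ?_
      have h1 : (X - 1 : ℝ[X]).natDegree ≤ 1 := by compute_degree
      have := (ih (i + 1)).1
      omega
    refine fun i => ⟨?_, hq i⟩
    change ((epsPoly e o (n + 1)).1 (i + 1) +
      C ((o (n + 1 + 1) (i + 1) - o (n + 1 + 1) i)⁻¹) *
        (epsPoly e o (n + 1 + 1)).2 (i + 1)).natDegree ≤ n + 1
    exact natDegree_add_le_of_degree_le ((ih _).1.trans (Nat.le_succ n))
      ((natDegree_C_mul_le _ _).trans (hq _))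

end

theorem shanks_unique (A : ℕ → ℝ) (j n : ℕ)
    (hI : fdet (fun m => A (m + 1) - A m) (fun _ => 1) j n ≠ 0)
    (p q : ℝ × (Fin n → ℝ))
    (hp : ∀ i : Fin (n + 1),
        A (j + i) = p.1 + ∑ k : Fin n, p.2 k * (A (j + i + k + 1) - A (j + i + k)))
    (hq : ∀ i : Fin (n + 1),
        A (j + i) = q.1 + ∑ k : Fin n, q.2 k * (A (j + i + k + 1) - A (j + i + k))) :
    p = q := by
  have hv := Matrix.eq_zero_of_mulVec_eq_zero hI
    (v := Fin.snoc (α := fun _ => ℝ) (fun k => p.2 k - q.2 k) (p.1 - q.1)) (by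
      funext i
      simp only [Matrix.mulVec, dotProduct, Matrix.of_apply, Fin.sum_univ_castSucc,
        Fin.snoc_castSucc, Fin.snoc_last, Fin.val_castSucc, Fin.is_lt, if_true, Fin.val_last,
        lt_irrefl, if_false, Pi.zero_apply]
      have h1 := hp i
      rw [hq i] at h1
      have h2 : ∑ k : Fin n, (A (j + i + k + 1) - A (j + i + k)) * (p.2 k - q.2 k) =
          ∑ k : Fin n, p.2 k * (A (j + i + k + 1) - A (j + i + k)) -
          ∑ k : Fin n, q.2 k * (A (j + i + k + 1) - A (j + i + k)) := by
        rw [← Finset.sum_sub_distrib]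
        exact Finset.sum_congr rfl fun k _ => by ring
      rw [h2]
      linarith)
  refine Prod.ext ?_ (funext fun k => ?_)
  · have := congrFun hv (Fin.last n)
    simp only [Fin.snoc_last, Pi.zero_apply] at this
    linarith
  · have := congrFun hv k.castSucc
    simp only [Fin.snoc_castSucc, Pi.zero_apply] at this
    linarith

theorem stmt_16 (A : ℕ → ℝ) (j n : ℕ) (hn : 1 ≤ n)
    (hdiff : ∀ j' k : ℕ, j ≤ j' → j' + k < j + 2 * n →
      epsRec A (k + 1) (j' + 1) ≠ epsRec A (k + 1) j')
    (hI : fdet (fun m => A (m + 1) - A m) (fun _ => 1) j n ≠ 0) :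
    (∃! p : ℝ × (Fin n → ℝ),
      ∀ i : Fin (n + 1),
        A (j + i) = p.1 + ∑ k : Fin n, p.2 k * (A (j + i + k + 1) - A (j + i + k))) ∧
    (∀ p : ℝ × (Fin n → ℝ),
      (∀ i : Fin (n + 1),
        A (j + i) = p.1 + ∑ k : Fin n, p.2 k * (A (j + i + k + 1) - A (j + i + k))) →
      epsRec A (2 * n + 1) j = p.1) := by
  set e : ℕ → ℕ → ℝ := fun m i => epsRec A (2 * m + 1) i with he_def
  set o : ℕ → ℕ → ℝ := fun m i => epsRec A (2 * m) i with ho_def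
  obtain ⟨hE, -⟩ := epsPoly_act A e o j (j + 2 * n)
    (fun i => by simp [he_def, epsRec]) (fun i => by simp [ho_def, epsRec])
    (fun m i => by
      change epsRec A (2 * m + 2) i = _
      rw [epsRec, one_div])
    (fun m i => by
      change epsRec A (2 * m + 1 + 2) i = _
      rw [epsRec, one_div]
      rfl)
    (fun m i hi h => sub_ne_zero.2 (hdiff i (2 * m) hi h))
    (fun m i hi h => sub_ne_zero.2 (hdiff i (2 * m + 1) hi h)) n
  set a := (epsPoly e o n).1 j with ha_def
  have hdeg : a.natDegree < n := by
    obtain ⟨m, rfl⟩ : ∃ m, n = m + 1 := ⟨n - 1, by omega⟩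
    exact Nat.lt_succ_of_le (epsPoly_natDegree e o m j).1
  have hsol : ∀ i : Fin (n + 1), A (j + i) = epsRec A (2 * n + 1) j +
      ∑ k : Fin n, (-a.coeff k) * (A (j + i + k + 1) - A (j + i + k)) := by
    intro i
    have h := hE j le_rfl le_rfl (j + i) (by omega) (by omega)
    rw [← ha_def, shiftAct_add, shiftAct_one, shiftAct_X_sub, shiftAct_eq_sum A a n _ hdeg,
      shiftAct_eq_sum A a n _ hdeg, ← Finset.sum_sub_distrib] at h
    change _ = epsRec A (2 * n + 1) j at h
    rw [← h, add_assoc, ← Finset.sum_add_distrib, Finset.sum_eq_zero, add_zero]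
    intro k _
    rw [show j + (i : ℕ) + 1 + k = j + i + k + 1 by omega]
    ring
  refine ⟨⟨(epsRec A (2 * n + 1) j, fun k => -a.coeff k), hsol, fun q hq =>
    shanks_unique A j n hI _ _ hq hsol⟩, fun p hp => ?_⟩
  rw [shanks_unique A j n hI p (epsRec A (2 * n + 1) j, fun k => -a.coeff k) hp hsol]
end
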